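/- arXiv:math/0507550 — 2 statements merged into one kernel-verified Lean document; each statement's English description precedes it below -/
import Mathlib

section
/- Let A be a 7-tuple with an identity 1, and let a ∈ A be one-sided invertible, say y ⇀ a = e₀ = a ↼ z for some y, z ∈ A and bar-unit e₀. Define Ψ_a(x) = (y ↼ x) ⇀ a. Then for all x₁, x₂ ∈ A: Ψ_a(x₁ + x₂) = Ψ_a(x₁) + Ψ_a(x₂), Ψ_a(x₁ ♯ x₂) = Ψ_a(x₁) ♯ Ψ_a(x₂), Ψ_a(x₁ ⇀ x₂) = Ψ_a(x₁) ⇀ Ψ_a(x₂), and Ψ_a(x₁ ↼ x₂) = Ψ_a(x₁) ↼ Ψ_a(x₂). -/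
/-- A 7-tuple: an abelian group with three binary operations `sharp` (♯),
`lp` (left product ⇀) and `rp` (right product ↼), each associative and
bi-distributive over `+`, satisfying the Hu-Liu triassociative law. -/
structure SevenTuple (A : Type*) [AddCommGroup A] where
  sharp : A → A → A
  lp : A → A → A
  rp : A → A → A
  sharp_assoc : ∀ x y z : A, sharp (sharp x y) z = sharp x (sharp y z)
  lp_assoc : ∀ x y z : A, lp (lp x y) z = lp x (lp y z)
  rp_assoc : ∀ x y z : A, rp (rp x y) z = rp x (rp y z)
  sharp_add_left : ∀ x y z : A, sharp (x + y) z = sharp x z + sharp y z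
  sharp_add_right : ∀ x y z : A, sharp x (y + z) = sharp x y + sharp x z
  lp_add_left : ∀ x y z : A, lp (x + y) z = lp x z + lp y z
  lp_add_right : ∀ x y z : A, lp x (y + z) = lp x y + lp x z
  rp_add_left : ∀ x y z : A, rp (x + y) z = rp x z + rp y z
  rp_add_right : ∀ x y z : A, rp x (y + z) = rp x y + rp x z
  tri1 : ∀ x y z : A, sharp (lp x y) z = sharp x (rp y z)
  tri2 : ∀ x y z : A, lp (sharp x y) z = sharp x (lp y z)
  tri3 : ∀ x y z : A, rp x (sharp y z) = sharp (rp x y) z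
  tri4 : ∀ x y z : A, lp x (sharp y z) = lp (lp x y) z
  tri5 : ∀ x y z : A, rp (sharp x y) z = rp (rp x y) z

variable {A : Type*} [AddCommGroup A]

/-- A bar-unit: `e ↼ x = x = x ⇀ e` for all `x`. -/
def SevenTuple.IsBarUnit (T : SevenTuple A) (e : A) : Prop :=
  ∀ x : A, T.rp e x = x ∧ T.lp x e = x

/-- An identity: `x ♯ 1 = x = 1 ♯ x` and `x ⇀ 1 = x = 1 ↼ x` for all `x`. -/
def SevenTuple.IsIdentity (T : SevenTuple A) (one : A) : Prop :=
  ∀ x : A, T.sharp x one = x ∧ T.sharp one x = x ∧ T.lp x one = x ∧ T.rp one x = x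

/-- The halo ℏ×(A): the set of bar-units. -/
def SevenTuple.halo (T : SevenTuple A) : Set A := {e | T.IsBarUnit e}

/-- The additive halo ℏ⁺(A) relative to a bar-unit `e`: `{α | e ⇀ α = 0}`. -/
def SevenTuple.addHalo (T : SevenTuple A) (e : A) : Set A := {α | T.lp e α = 0}

/-- The Hu-Liu product induced by `e`: `x • y = x ↼ y + x ⇀ y − (x ↼ e) ⇀ y`. -/
def SevenTuple.bullet (T : SevenTuple A) (e x y : A) : A :=
  T.rp x y + T.lp x y - T.lp (T.rp x e) y

/-- The angle bracket `⟨x, y⟩ = x ⇀ y − y ↼ x`. -/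
def SevenTuple.angle (T : SevenTuple A) (x y : A) : A := T.lp x y - T.rp y x

/-- The square bracket `[x, y] = x ♯ y − y ♯ x`. -/
def SevenTuple.sq (T : SevenTuple A) (x y : A) : A := T.sharp x y - T.sharp y x

namespace SevenTuple

variable {T : SevenTuple A} {one : A}

theorem lp_eq_sharp (h : T.IsIdentity one) (x y : A) :
    T.lp x y = T.sharp x (T.lp one y) := by
  rw [← T.tri2, (h x).1]

theorem rp_one_eq_one_lp (h : T.IsIdentity one) (x : A) : T.rp x one = T.lp one x := by
  have := T.tri1 one x one
  rw [(h _).1, (h _).2.1] at this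
  exact this.symm

theorem rp_eq_sharp (h : T.IsIdentity one) (x y : A) :
    T.rp x y = T.sharp (T.lp one x) y := by
  rw [← rp_one_eq_one_lp h, ← T.tri3, (h y).2.1]

theorem one_lp_sharp (h : T.IsIdentity one) (x y : A) :
    T.lp one (T.sharp x y) = T.sharp (T.lp one x) (T.lp one y) := by
  rw [T.tri4, lp_eq_sharp h]

theorem one_lp_one_lp (h : T.IsIdentity one) (x : A) :
    T.lp one (T.lp one x) = T.lp one x := by
  rw [← T.lp_assoc, (h one).2.2.1]

/-- The image of `y` under `1 ⇀ ·`, a left inverse of the image of `a`, is also a right inverse. -/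
theorem one_lp_sharp_one_lp_eq_one (h : T.IsIdentity one) {a y z e : A} (he : T.IsBarUnit e)
    (hy : T.lp y a = e) (hz : T.rp a z = e) :
    T.sharp (T.lp one a) (T.lp one y) = one := by
  have hl : T.sharp (T.lp one y) (T.lp one a) = one := by
    rw [← lp_eq_sharp h, T.lp_assoc, hy, (he one).2]
  have hr : T.sharp (T.lp one a) (T.lp one z) = one := by
    rw [← one_lp_one_lp h a, ← one_lp_sharp h, ← rp_eq_sharp h, hz, (he one).2]
  have hyz : T.lp one y = T.lp one z := calc
    T.lp one y = T.sharp (T.lp one y) (T.sharp (T.lp one a) (T.lp one z)) := by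
      rw [hr, (h _).1]
    _ = T.lp one z := by rw [← T.sharp_assoc, hl, (h _).2.1]
  rw [hyz, hr]

end SevenTuple

/-- The diconjugation `Ψ_a` preserves `+`, ♯, ⇀ and ↼. -/
theorem diconjugation_preserves_ops (T : SevenTuple A) (one : A)
    (hone : T.IsIdentity one) (a y z e₀ : A) (he₀ : T.IsBarUnit e₀)
    (hy : T.lp y a = e₀) (hz : T.rp a z = e₀) :
    ∀ x₁ x₂ : A,
      T.lp (T.rp y (x₁ + x₂)) a = T.lp (T.rp y x₁) a + T.lp (T.rp y x₂) a ∧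
      T.lp (T.rp y (T.sharp x₁ x₂)) a
        = T.sharp (T.lp (T.rp y x₁) a) (T.lp (T.rp y x₂) a) ∧
      T.lp (T.rp y (T.lp x₁ x₂)) a
        = T.lp (T.lp (T.rp y x₁) a) (T.lp (T.rp y x₂) a) ∧
      T.lp (T.rp y (T.rp x₁ x₂)) a
        = T.rp (T.lp (T.rp y x₁) a) (T.lp (T.rp y x₂) a) := by
  have hinv := SevenTuple.one_lp_sharp_one_lp_eq_one hone he₀ hy hz
  have cancel : ∀ w, T.sharp (T.lp one a) (T.sharp (T.lp one y) w) = w := fun w => by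
    rw [← T.sharp_assoc, hinv, (hone w).2.1]
  have lp_eq : ∀ u v, T.lp u v = T.sharp u (T.lp one v) := SevenTuple.lp_eq_sharp hone
  have rp_eq : ∀ u v, T.rp u v = T.sharp (T.lp one u) v := SevenTuple.rp_eq_sharp hone
  have conj_eq : ∀ x, T.lp (T.rp y x) a =
      T.sharp (T.lp one y) (T.sharp x (T.lp one a)) := fun x => by
    rw [lp_eq, rp_eq, T.sharp_assoc]
  have conj_sharp : ∀ u v, T.lp (T.rp y (T.sharp u v)) a =
      T.sharp (T.lp (T.rp y u) a) (T.lp (T.rp y v) a) := fun u v => by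
    simp only [conj_eq, T.sharp_assoc, cancel]
  have conj_one_lp : ∀ u, T.lp (T.rp y (T.lp one u)) a =
      T.lp one (T.lp (T.rp y u) a) := fun u => by
    simp only [conj_eq, SevenTuple.one_lp_sharp hone, SevenTuple.one_lp_one_lp hone]
  intro x₁ x₂
  refine ⟨by rw [T.rp_add_right, T.lp_add_left], conj_sharp x₁ x₂, ?_, ?_⟩
  · rw [lp_eq x₁ x₂, conj_sharp, conj_one_lp, ← lp_eq]
  · rw [rp_eq x₁ x₂, conj_sharp, conj_one_lp, ← rp_eq]
end

section
/- Let A be a 7-tuple with an identity 1. Define the angle bracket ⟨x, y⟩ := x ⇀ y − y ↼ x. Then ⟨·,·⟩ satisfies the Leibniz identity: ⟨x, ⟨y, z⟩⟩ = ⟨⟨x, y⟩, z⟩ − ⟨⟨x, z⟩, y⟩ for all x, y, z ∈ A. -/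
variable {A : Type*} [AddCommGroup A]

namespace SevenTuple

variable (T : SevenTuple A)

lemma sharp_sub_left (x y z : A) :
    T.sharp (x - y) z = T.sharp x z - T.sharp y z :=
  map_sub (AddMonoidHom.mk' (fun a => T.sharp a z) fun a b => T.sharp_add_left a b z) x y

lemma sharp_sub_right (x y z : A) :
    T.sharp x (y - z) = T.sharp x y - T.sharp x z :=
  map_sub (AddMonoidHom.mk' (T.sharp x) (T.sharp_add_right x)) y z

lemma lp_sub_right (x y z : A) : T.lp x (y - z) = T.lp x y - T.lp x z :=
  map_sub (AddMonoidHom.mk' (T.lp x) (T.lp_add_right x)) y z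

namespace IsIdentity

variable {T} {one : A}

/-- The left product is the sharp product twisted by `y ↦ 1 ⇀ y` on the right. -/
lemma lp_eq (hone : T.IsIdentity one) (x y : A) : T.lp x y = T.sharp x (T.lp one y) := by
  rw [← T.tri2, (hone x).1]

lemma rp_one (hone : T.IsIdentity one) (x : A) : T.rp x one = T.lp one x := by
  have h := T.tri1 one x one
  rwa [(hone _).1, (hone _).2.1, eq_comm] at h

/-- The right product is the sharp product twisted by `x ↦ 1 ⇀ x` on the left. -/
lemma rp_eq (hone : T.IsIdentity one) (x y : A) : T.rp x y = T.sharp (T.lp one x) y := by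
  rw [← hone.rp_one, ← T.tri3, (hone y).2.1]

/-- The map `x ↦ 1 ⇀ x` is multiplicative for the sharp product. -/
lemma one_lp_sharp (hone : T.IsIdentity one) (x y : A) :
    T.lp one (T.sharp x y) = T.sharp (T.lp one x) (T.lp one y) := by
  rw [T.tri4, hone.lp_eq (T.lp one x)]

/-- The map `x ↦ 1 ⇀ x` is idempotent. -/
lemma one_lp_one_lp (hone : T.IsIdentity one) (x : A) : T.lp one (T.lp one x) = T.lp one x := by
  rw [← T.lp_assoc, (hone one).2.2.1]

lemma angle_eq_sq (hone : T.IsIdentity one) (x y : A) : T.angle x y = T.sq x (T.lp one y) := by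
  rw [angle, sq, hone.lp_eq x, hone.rp_eq]

end IsIdentity

end SevenTuple

/-- The angle bracket of a 7-tuple with identity satisfies the Leibniz
identity: `⟨x,⟨y,z⟩⟩ = ⟨⟨x,y⟩,z⟩ − ⟨⟨x,z⟩,y⟩`. -/
theorem angle_leibniz (T : SevenTuple A) (one : A) (hone : T.IsIdentity one) :
    ∀ x y z : A,
      T.angle x (T.angle y z) = T.angle (T.angle x y) z - T.angle (T.angle x z) y := by
  intro x y z
  simp only [hone.angle_eq_sq, SevenTuple.sq, T.lp_sub_right, T.sharp_sub_left,
    T.sharp_sub_right, hone.one_lp_sharp, hone.one_lp_one_lp, T.sharp_assoc]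
  abel
end
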